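/- For every α ∈ Δ₊^c and every β ∈ Δ₊^{nc,1} ∪ Δ₊^{nc,2}: if α + β is a root of Δ then α + β ∈ Δ₊^{nc,1} ∪ Δ₊^{nc,2}, and if α − β is a root of Δ then β − α ∈ Δ₊^{nc,1} ∪ Δ₊^{nc,2}. -/

import Mathlib

open scoped RealInnerProductSpace

/-- A finite reduced crystallographic root system spanning a finite-dimensional
real inner product space `V`. -/
structure IsRootSystem {V : Type*} [NormedAddCommGroup V] [InnerProductSpace ℝ V]
    [FiniteDimensional ℝ V] (Δ : Set V) : Prop where
  finite : Δ.Finite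
  zero_not_mem : (0 : V) ∉ Δ
  span_eq_top : Submodule.span ℝ Δ = ⊤
  reflection_mem : ∀ α ∈ Δ, ∀ β ∈ Δ, β - (2 * ⟪β, α⟫ / ⟪α, α⟫) • α ∈ Δ
  crystallographic : ∀ α ∈ Δ, ∀ β ∈ Δ, ∃ n : ℤ, 2 * ⟪β, α⟫ / ⟪α, α⟫ = (n : ℝ)
  reduced : ∀ α ∈ Δ, ∀ c : ℝ, c • α ∈ Δ → c = 1 ∨ c = -1

/-- A partition `Δ = Δc ⊔ Δnc` into compact and noncompact roots, closed under
negation, and such that sums of roots obey the parity rules. -/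
structure IsCompactDecomp {V : Type*} [NormedAddCommGroup V] [InnerProductSpace ℝ V]
    [FiniteDimensional ℝ V] (Δ Δc Δnc : Set V) : Prop where
  union_eq : Δc ∪ Δnc = Δ
  inter_eq : Δc ∩ Δnc = ∅
  neg_c : ∀ α ∈ Δc, -α ∈ Δc
  neg_nc : ∀ α ∈ Δnc, -α ∈ Δnc
  add_cc : ∀ α ∈ Δc, ∀ β ∈ Δc, α + β ∈ Δ → α + β ∈ Δc
  add_ncnc : ∀ α ∈ Δnc, ∀ β ∈ Δnc, α + β ∈ Δ → α + β ∈ Δc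
  add_cnc : ∀ α ∈ Δc, ∀ β ∈ Δnc, α + β ∈ Δ → α + β ∈ Δnc

/-- A choice of positive roots `Δp` in the root system `Δ`. -/
structure IsPositiveSystem {V : Type*} [NormedAddCommGroup V] [InnerProductSpace ℝ V]
    [FiniteDimensional ℝ V] (Δ Δp : Set V) : Prop where
  subset : Δp ⊆ Δ
  mem_or_neg_mem : ∀ α ∈ Δ, α ∈ Δp ∨ -α ∈ Δp
  neg_not_mem : ∀ α ∈ Δp, -α ∉ Δp
  add_mem : ∀ α ∈ Δp, ∀ β ∈ Δp, α + β ∈ Δ → α + β ∈ Δp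

/-- `Δ` is irreducible: it is not the union of two nonempty mutually orthogonal subsets. -/
def RootIrreducible {V : Type*} [NormedAddCommGroup V] [InnerProductSpace ℝ V]
    [FiniteDimensional ℝ V] (Δ : Set V) : Prop :=
  ¬ ∃ Δ₁ Δ₂ : Set V, Δ₁.Nonempty ∧ Δ₂.Nonempty ∧ Δ₁ ∪ Δ₂ = Δ ∧
      ∀ α ∈ Δ₁, ∀ β ∈ Δ₂, ⟪α, β⟫ = 0

namespace IsRootSystem

variable {V : Type*} [NormedAddCommGroup V] [InnerProductSpace ℝ V] [FiniteDimensional ℝ V]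
  {Δ : Set V}

theorem ne_zero (h : IsRootSystem Δ) {a : V} (ha : a ∈ Δ) : a ≠ 0 :=
  fun h0 => h.zero_not_mem (h0 ▸ ha)

theorem inner_self_pos (h : IsRootSystem Δ) {a : V} (ha : a ∈ Δ) : 0 < ⟪a, a⟫ :=
  real_inner_self_pos.2 (h.ne_zero ha)

/-- If `⟪b, a⟫ < 0`, then either `a + b` is a root or the Cartan integer of `b` along `a`
is at most `-2`. -/
theorem add_mem_or_inner_self_le (h : IsRootSystem Δ) {a b : V} (ha : a ∈ Δ) (hb : b ∈ Δ)
    (hab : ⟪b, a⟫ < 0) : a + b ∈ Δ ∨ ⟪a, a⟫ ≤ -⟪b, a⟫ := by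
  obtain ⟨n, hn⟩ := h.crystallographic a ha b hb
  have hpos := h.inner_self_pos ha
  have hmul : 2 * ⟪b, a⟫ = n * ⟪a, a⟫ := (div_eq_iff hpos.ne').1 hn
  have hn0 : n < 0 := by
    by_contra! hcon
    have : (0 : ℝ) ≤ n := by exact_mod_cast hcon
    nlinarith
  rcases eq_or_ne n (-1) with rfl | hne
  · left
    have := h.reflection_mem a ha b hb
    rw [hn] at this
    simpa [add_comm] using this
  · right
    have : (n : ℝ) ≤ -2 := by exact_mod_cast (by omega : n ≤ -2)
    nlinarith

theorem add_mem_of_inner_neg (h : IsRootSystem Δ) {a b : V} (ha : a ∈ Δ) (hb : b ∈ Δ)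
    (hab : ⟪a, b⟫ < 0) (h0 : a + b ≠ 0) : a + b ∈ Δ := by
  have hcomm := real_inner_comm a b
  rcases h.add_mem_or_inner_self_le ha hb (by linarith) with hm | hle
  · exact hm
  rcases h.add_mem_or_inner_self_le hb ha hab with hm | hle'
  · rwa [add_comm]
  have hsq := real_inner_self_pos.2 h0
  simp only [inner_add_left, inner_add_right] at hsq
  linarith

theorem neg_mem (h : IsRootSystem Δ) {a : V} (ha : a ∈ Δ) : -a ∈ Δ := by
  have := h.reflection_mem a ha a ha
  rw [mul_div_assoc, div_self (h.inner_self_pos ha).ne', mul_one, two_smul] at this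
  simpa using this

/-- If `a`, `b`, `c` and `a + b + c` are roots and no two of the relevant summands cancel,
then `a + b` or `a + c` is a root. -/
theorem add_mem_or_add_mem (h : IsRootSystem Δ) {a b c : V} (ha : a ∈ Δ) (hb : b ∈ Δ)
    (hc : c ∈ Δ) (hd : a + (b + c) ∈ Δ) (hab : a + b ≠ 0) (hac : a + c ≠ 0)
    (hbc : b + c ≠ 0) : a + b ∈ Δ ∨ a + c ∈ Δ := by
  by_contra! hcon
  obtain ⟨hnb, hnc⟩ := hcon
  have h1 : 0 ≤ ⟪a, b⟫ := not_lt.1 fun hlt => hnb (h.add_mem_of_inner_neg ha hb hlt hab)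
  have h2 : 0 ≤ ⟪a, c⟫ := not_lt.1 fun hlt => hnc (h.add_mem_of_inner_neg ha hc hlt hac)
  have eb : a + (b + c) + -b = a + c := by abel
  have ec : a + (b + c) + -c = a + b := by abel
  have h3 : ⟪a + (b + c), b⟫ ≤ 0 := by
    by_contra! hlt
    refine hnc (eb ▸ h.add_mem_of_inner_neg hd (h.neg_mem hb) ?_ (eb ▸ hac))
    rw [inner_neg_right]
    linarith
  have h4 : ⟪a + (b + c), c⟫ ≤ 0 := by
    by_contra! hlt
    refine hnb (ec ▸ h.add_mem_of_inner_neg hd (h.neg_mem hc) ?_ (ec ▸ hab))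
    rw [inner_neg_right]
    linarith
  have hsq := real_inner_self_pos.2 hbc
  simp only [inner_add_left, inner_add_right] at h3 h4 hsq
  linarith

end IsRootSystem

theorem IsPositiveSystem.add_ne_zero {V : Type*} [NormedAddCommGroup V]
    [InnerProductSpace ℝ V] [FiniteDimensional ℝ V] {Δ Δp : Set V}
    (h : IsPositiveSystem Δ Δp) {a b : V} (ha : a ∈ Δp) (hb : b ∈ Δp) : a + b ≠ 0 :=
  fun h0 => h.neg_not_mem a ha (neg_eq_of_add_eq_zero_right h0 ▸ hb)

/-- Property III: `Δ₊^c +_Δ (Δ₊^{nc,1} ∪ Δ₊^{nc,2}) ⊆ Δ₊^{nc,1} ∪ Δ₊^{nc,2}` and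
`Δ₊^c -_Δ (Δ₊^{nc,1} ∪ Δ₊^{nc,2}) ⊆ -(Δ₊^{nc,1} ∪ Δ₊^{nc,2})`. -/
theorem compact_pm_nc12 {V : Type*} [NormedAddCommGroup V]
    [InnerProductSpace ℝ V] [FiniteDimensional ℝ V] (Δ Δc Δnc Δp : Set V)
    (hRS : IsRootSystem Δ) (hCD : IsCompactDecomp Δ Δc Δnc) (hPS : IsPositiveSystem Δ Δp)
    (lam : V)
    (h1 : ∀ α ∈ Δc ∩ Δp, 0 ≤ ⟪lam, α⟫)
    (h2 : ∀ β ∈ Δnc ∩ Δp, ⟪lam, β⟫ ≤ 0)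
    (nc1 nc2 : Set V)
    (hnc1 : nc1 = {β | β ∈ Δnc ∩ Δp ∧ ⟪lam, β⟫ < 0})
    (hnc2 : nc2 = {β | β ∈ Δnc ∩ Δp ∧ ⟪lam, β⟫ = 0 ∧
      ∃ α ∈ Δc ∩ Δp, ∃ β' ∈ nc1, β = α + β'}) :
    ∀ α ∈ Δc ∩ Δp, ∀ β ∈ nc1 ∪ nc2,
      (α + β ∈ Δ → α + β ∈ nc1 ∪ nc2) ∧ (α - β ∈ Δ → β - α ∈ nc1 ∪ nc2) := by
  subst hnc1 hnc2
  have hcΔ : ∀ {x}, x ∈ Δc → x ∈ Δ := fun hx => hCD.union_eq ▸ Or.inl hx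
  have hncΔ : ∀ {x}, x ∈ Δnc → x ∈ Δ := fun hx => hCD.union_eq ▸ Or.inr hx
  have add_c : ∀ {x y}, x ∈ Δc ∩ Δp → y ∈ Δc ∩ Δp → x + y ∈ Δ → x + y ∈ Δc ∩ Δp :=
    fun hx hy hxy => ⟨hCD.add_cc _ hx.1 _ hy.1 hxy, hPS.add_mem _ hx.2 _ hy.2 hxy⟩
  have add_nc : ∀ {x y}, x ∈ Δc ∩ Δp → y ∈ Δnc ∩ Δp → x + y ∈ Δ → x + y ∈ Δnc ∩ Δp :=
    fun hx hy hxy => ⟨hCD.add_cnc _ hx.1 _ hy.1 hxy, hPS.add_mem _ hx.2 _ hy.2 hxy⟩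
  have pos_c : ∀ {x}, x ∈ Δc → 0 < ⟪lam, x⟫ → x ∈ Δc ∩ Δp := by
    refine fun {x} hx hlt => ⟨hx, (hPS.mem_or_neg_mem x (hcΔ hx)).resolve_right fun hneg => ?_⟩
    have := h1 _ ⟨hCD.neg_c x hx, hneg⟩
    rw [inner_neg_right] at this
    linarith
  have pos_nc : ∀ {x}, x ∈ Δnc → ⟪lam, x⟫ < 0 → x ∈ Δnc ∩ Δp := by
    refine fun {x} hx hlt => ⟨hx, (hPS.mem_or_neg_mem x (hncΔ hx)).resolve_right fun hneg => ?_⟩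
    have := h2 _ ⟨hCD.neg_nc x hx, hneg⟩
    rw [inner_neg_right] at this
    linarith
  have sub_nc : ∀ {x y}, x ∈ Δc → y ∈ Δnc → -x + y ∈ Δ → -x + y ∈ Δnc :=
    fun hx hy hxy => hCD.add_cnc _ (hCD.neg_c _ hx) _ hy hxy
  -- A positive noncompact root that splits as required lies in one of the two sets.
  have split : ∀ {x y}, x ∈ Δc ∩ Δp → y ∈ Δnc ∩ Δp → ⟪lam, y⟫ < 0 → x + y ∈ Δ →
      x + y ∈ {β | β ∈ Δnc ∩ Δp ∧ ⟪lam, β⟫ < 0} ∪ {β | β ∈ Δnc ∩ Δp ∧ ⟪lam, β⟫ = 0 ∧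
      ∃ α ∈ Δc ∩ Δp, ∃ β' ∈ {β | β ∈ Δnc ∩ Δp ∧ ⟪lam, β⟫ < 0}, β = α + β'} := by
    intro x y hx hy hlt hxy
    have hm := add_nc hx hy hxy
    rcases (h2 _ hm).lt_or_eq with hlt' | heq
    · exact Or.inl ⟨hm, hlt'⟩
    · exact Or.inr ⟨hm, heq, x, hx, y, ⟨hy, hlt⟩, rfl⟩
  rintro α hα β hβ
  have hαl := h1 α hα
  have sub_eq : α - β = -(-α + β) := by abel
  have sub_eq' : β - α = -α + β := by abel
  have sub_mem : α - β ∈ Δ → -α + β ∈ Δ := fun hr => by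
    simpa [sub_eq] using hRS.neg_mem hr
  rw [sub_eq']
  have sub_neg : β ∈ Δnc → ⟪lam, β⟫ < ⟪lam, α⟫ → -α + β ∈ Δ →
      -α + β ∈ {β | β ∈ Δnc ∩ Δp ∧ ⟪lam, β⟫ < 0} := fun hb hlt hr => by
    have hl : ⟪lam, -α + β⟫ < 0 := by
      rw [inner_add_right, inner_neg_right]
      linarith
    exact ⟨pos_nc (sub_nc hα.1 hb hr) hl, hl⟩
  rcases hβ with ⟨hβ, hlt⟩ | ⟨hβ, heq, α', hα', β', ⟨hβ', hlt'⟩, rfl⟩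
  · exact ⟨split hα hβ hlt, fun hr => Or.inl (sub_neg hβ.1 (by linarith) (sub_mem hr))⟩
  have hβne := hPS.add_ne_zero hα'.2 hβ'.2
  rw [inner_add_right] at heq
  refine ⟨fun hr => ?_, fun hr => ?_⟩
  · have hle := h2 _ (add_nc hα hβ hr)
    simp only [inner_add_right] at hle
    rcases hRS.add_mem_or_add_mem (hcΔ hα.1) (hcΔ hα'.1) (hncΔ hβ'.1) hr
      (hPS.add_ne_zero hα.2 hα'.2) (hPS.add_ne_zero hα.2 hβ'.2) hβne with hm | hm
    · rw [← add_assoc] at hr ⊢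
      exact split (add_c hα hα' hm) hβ' hlt' hr
    · rw [add_left_comm] at hr ⊢
      refine split hα' (add_nc hα hβ' hm) ?_ hr
      rw [inner_add_right]
      linarith
  · replace hr := sub_mem hr
    rcases hαl.lt_or_eq with hpos | hzero
    · refine Or.inl (sub_neg hβ.1 ?_ hr)
      rw [inner_add_right]
      linarith
    have hl : ∀ x, ⟪lam, -α + x⟫ = ⟪lam, x⟫ := fun x => by
      rw [inner_add_right, inner_neg_right, ← hzero, neg_zero, zero_add]
    have hne : ∀ x, ⟪lam, x⟫ ≠ 0 → -α + x ≠ 0 := fun x hx h0 => hx <| by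
      rw [← hl, h0, inner_zero_right]
    have hα'l : 0 < ⟪lam, α'⟫ := by linarith
    rcases hRS.add_mem_or_add_mem (hRS.neg_mem (hcΔ hα.1)) (hcΔ hα'.1) (hncΔ hβ'.1) hr
      (hne _ hα'l.ne') (hne _ hlt'.ne) hβne with hm | hm
    · rw [← add_assoc] at hr ⊢
      have hmc := hCD.add_cc _ (hCD.neg_c _ hα.1) _ hα'.1 hm
      exact split (pos_c hmc (by rwa [hl])) hβ' hlt' hr
    · rw [add_left_comm] at hr ⊢
      have hlm : ⟪lam, -α + β'⟫ < 0 := by rwa [hl]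
      exact split hα' (pos_nc (sub_nc hα.1 hβ'.1 hm) hlm) hlm hr
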